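/- Fix m ≥ 2, a bounded open connected set Ω ⊂ ℝ^m, and l, N ∈ ℕ. Let V_i^j : ℝ^m × ℝ^l → ℝ (i = 1,…,5, j = 1,…,m) be maps that are real analytic on a neighborhood of cl(Ω) × ℝ^l, and suppose that for some ẑ ∈ ℝ^l the Lie algebra Lie(V_1(·,ẑ),…,V_5(·,ẑ)) contains every polynomial vector field on ℝ^m. Then there exists a Lebesgue nullset ℳ_N ⊂ ℝ^l such that for every z ∈ ℝ^l ∖ ℳ_N there exists a Lebesgue nullset 𝒩_N ⊂ Ω^N (depending on z) such that Lie(V_1(·,z),…,V_5(·,z)) interpolates at every tuple (x_1,…,x_N) ∈ Ω^N ∖ 𝒩_N. -/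

import Mathlib

open Set MeasureTheory

noncomputable section

/-- The Lie bracket `[U,V](x) = DV(x)·U(x) − DU(x)·V(x)` of two vector fields. -/
def lieBracketVF {F : Type*} [NormedAddCommGroup F] [NormedSpace ℝ F]
    (U V : F → F) : F → F :=
  fun x => fderiv ℝ V x (U x) - fderiv ℝ U x (V x)

/-- `lieGen S` is the smallest ℝ-linear subspace of vector fields containing `S`
and closed under the Lie bracket. -/
def lieGen {F : Type*} [NormedAddCommGroup F] [NormedSpace ℝ F]
    (S : Set (F → F)) : Set (F → F) :=
  ⋂₀ {T : Set (F → F) | S ⊆ T ∧ (0 : F → F) ∈ T ∧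
      (∀ f g, f ∈ T → g ∈ T → f + g ∈ T) ∧
      (∀ (c : ℝ) f, f ∈ T → c • f ∈ T) ∧
      (∀ f g, f ∈ T → g ∈ T → lieBracketVF f g ∈ T)}

/-- A polynomial vector field on `ℝ^m`. -/
def IsPolyVF {m : ℕ} (V : EuclideanSpace ℝ (Fin m) → EuclideanSpace ℝ (Fin m)) : Prop :=
  ∃ p : Fin m → MvPolynomial (Fin m) ℝ,
    ∀ x j, V x j = MvPolynomial.eval (fun k => x k) (p j)

/-- A collection `𝒱` of vector fields interpolates at the tuple `(x_1,…,x_N)` if for every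
`(v_1,…,v_N)` there is `V̂ ∈ 𝒱` with `V̂(x_i) = v_i` for all `i`. -/
def Interpolates {F : Type*} {N : ℕ} (𝒱 : Set (F → F)) (x : Fin N → F) : Prop :=
  ∀ v : Fin N → F, ∃ Vh ∈ 𝒱, ∀ i, Vh (x i) = v i

/-- A set whose intersection with every line through the origin is null is itself null. -/
theorem measure_eq_zero_of_forall_smul_mem {E : Type*} [NormedAddCommGroup E] [NormedSpace ℝ E]
    [FiniteDimensional ℝ E] [MeasurableSpace E] [BorelSpace E] (μ : Measure E)
    [μ.IsAddHaarMeasure] {A : Set E} (hA : MeasurableSet A)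
    (h : ∀ x : E, volume {t : ℝ | t • x ∈ A} = 0) : μ A = 0 := by
  have : ProperSpace E := FiniteDimensional.proper ℝ E
  have hS : MeasurableSet {p : E × ℝ | p.2 • p.1 ∈ A} :=
    (measurable_snd.smul measurable_fst) hA
  have h₁ : (μ.prod volume) {p : E × ℝ | p.2 • p.1 ∈ A} = 0 :=
    (Measure.measure_prod_null hS).2 (Filter.Eventually.of_forall h)
  have h₂ : ∀ᵐ t : ℝ, μ ((fun x : E => t • x) ⁻¹' A) = 0 := by
    rw [← Measure.prod_swap, Measure.map_apply measurable_swap hS,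
      Measure.measure_prod_null (measurable_swap hS)] at h₁
    exact h₁
  obtain ⟨t, ht, ht0⟩ := (h₂.and (Measure.ae_ne volume (0 : ℝ))).exists
  rw [Measure.addHaar_preimage_smul μ ht0, mul_eq_zero] at ht
  refine ht.resolve_left ?_
  simp [ht0]

/-- The zero set of a nontrivial real analytic function on a connected open set is null. -/
theorem AnalyticOnNhd.measure_zeros_eq_zero {E : Type*} [NormedAddCommGroup E] [NormedSpace ℝ E]
    [FiniteDimensional ℝ E] [MeasurableSpace E] [BorelSpace E] (μ : Measure E)
    [μ.IsAddHaarMeasure] {f : E → ℝ} {W : Set E} (hf : AnalyticOnNhd ℝ f W) (hW : IsOpen W)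
    (hWc : IsPreconnected W) {p : E} (hp : p ∈ W) (hfp : f p ≠ 0) :
    μ {x | x ∈ W ∧ f x = 0} = 0 := by
  have : ProperSpace E := FiniteDimensional.proper ℝ E
  refine measure_null_of_locally_null _ fun x hx => ?_
  obtain ⟨r, hr, hrW⟩ := Metric.isOpen_iff.1 hW x hx.1
  obtain ⟨y, hy, hfy⟩ : ∃ y ∈ Metric.ball x r, f y ≠ 0 := by
    by_contra! hcon
    exact hfp (hf.eqOn_zero_of_preconnected_of_eventuallyEq_zero hWc hx.1
      (Filter.eventually_of_mem (Metric.ball_mem_nhds x hr) hcon) hp)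
  refine ⟨Metric.ball x r ∩ {x | x ∈ W ∧ f x = 0},
    Filter.inter_mem (mem_nhdsWithin_of_mem_nhds (Metric.ball_mem_nhds x hr))
      self_mem_nhdsWithin, ?_⟩
  have hfB : AnalyticOnNhd ℝ f (Metric.ball x r) := hf.mono hrW
  have hmeas : MeasurableSet {z | z ∈ Metric.ball x r ∧ f z = 0} := by
    have hopen := hfB.continuousOn.isOpen_inter_preimage Metric.isOpen_ball
      (isOpen_compl_singleton (x := (0 : ℝ)))
    convert Metric.isOpen_ball.measurableSet.diff hopen.measurableSet using 1
    ext z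
    simp only [mem_ofPred_eq, mem_sdiff, mem_inter_iff, mem_preimage, mem_compl_iff,
      mem_singleton_iff]
    tauto
  have hsub : Metric.ball x r ∩ {x | x ∈ W ∧ f x = 0} ⊆ {z | z ∈ Metric.ball x r ∧ f z = 0} :=
    fun z hz => ⟨hz.1, hz.2.2⟩
  refine measure_mono_null hsub ?_
  rw [← measure_preimage_add μ y]
  refine measure_eq_zero_of_forall_smul_mem μ (measurable_const_add y hmeas) fun v => ?_
  set I : Set ℝ := {t : ℝ | y + t • v ∈ Metric.ball x r} with hI
  have hIo : IsOpen I := Metric.isOpen_ball.preimage (by fun_prop)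
  have hIc : Convex ℝ I := by
    have h := ((convex_ball x r).translate_preimage_right y).linear_preimage
      (LinearMap.toSpanSingleton ℝ E v)
    exact h
  have hg : AnalyticOnNhd ℝ (fun t : ℝ => f (y + t • v)) I := fun t ht =>
    AnalyticAt.fun_comp (hfB _ ht) (by fun_prop)
  have hae := ae_restrict_le_codiscreteWithin (μ := volume) hIo.measurableSet
    (hg.preimage_zero_mem_codiscreteWithin (x := 0) (by simpa using hfy) (by simpa [hI] using hy)
      ⟨⟨0, by simpa [hI] using hy⟩, hIc.isPreconnected⟩)
  rw [mem_ae_iff, Measure.restrict_apply₀' hIo.measurableSet.nullMeasurableSet] at hae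
  refine measure_mono_null (fun t ht => ?_) hae
  exact ⟨fun h => h ht.2, ht.1⟩

theorem add_mem_lieGen {F : Type*} [NormedAddCommGroup F] [NormedSpace ℝ F] {S : Set (F → F)}
    {f g : F → F} (hf : f ∈ lieGen S) (hg : g ∈ lieGen S) : f + g ∈ lieGen S :=
  fun T hT => hT.2.2.1 f g (hf T hT) (hg T hT)

theorem smul_mem_lieGen {F : Type*} [NormedAddCommGroup F] [NormedSpace ℝ F] {S : Set (F → F)}
    (c : ℝ) {f : F → F} (hf : f ∈ lieGen S) : c • f ∈ lieGen S :=
  fun T hT => hT.2.2.2.1 c f (hf T hT)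

theorem zero_mem_lieGen {F : Type*} [NormedAddCommGroup F] [NormedSpace ℝ F] {S : Set (F → F)} :
    (0 : F → F) ∈ lieGen S :=
  fun _ hT => hT.2.1

theorem lieBracketVF_mem_lieGen {F : Type*} [NormedAddCommGroup F] [NormedSpace ℝ F]
    {S : Set (F → F)} {f g : F → F} (hf : f ∈ lieGen S) (hg : g ∈ lieGen S) :
    lieBracketVF f g ∈ lieGen S :=
  fun T hT => hT.2.2.2.2 f g (hf T hT) (hg T hT)

theorem sum_smul_mem_lieGen {F ι : Type*} [NormedAddCommGroup F] [NormedSpace ℝ F]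
    {S : Set (F → F)} (s : Finset ι) (c : ι → ℝ) {f : ι → F → F} (hf : ∀ i, f i ∈ lieGen S) :
    ∑ i ∈ s, c i • f i ∈ lieGen S :=
  Finset.sum_induction _ (· ∈ lieGen S) (fun _ _ => add_mem_lieGen) zero_mem_lieGen
    fun i _ => smul_mem_lieGen (c i) (hf i)

/-- The Lie bracket in the first variable of parametrized analytic vector fields is analytic. -/
theorem AnalyticOnNhd.lieBracketVF_fst {E Z : Type*} [NormedAddCommGroup E] [NormedSpace ℝ E]
    [CompleteSpace E] [NormedAddCommGroup Z] [NormedSpace ℝ Z] {U : Set (E × Z)} (hU : IsOpen U)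
    {F G : E × Z → E} (hF : AnalyticOnNhd ℝ F U) (hG : AnalyticOnNhd ℝ G U) :
    AnalyticOnNhd ℝ
      (fun p => lieBracketVF (fun x => F (x, p.2)) (fun x => G (x, p.2)) p.1) U := by
  have key : ∀ H : E × Z → E, AnalyticOnNhd ℝ H U → ∀ p ∈ U, ∀ w : E,
      fderiv ℝ (fun x => H (x, p.2)) p.1 w = fderiv ℝ H p (w, 0) := by
    intro H hH p hp w
    have h₁ : HasFDerivAt (fun x : E => (x, p.2)) (ContinuousLinearMap.inl ℝ E Z) p.1 :=
      hasFDerivAt_prodMk_left p.1 p.2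
    have h₂ : HasFDerivAt H (fderiv ℝ H p) (p.1, p.2) := (hH p hp).differentiableAt.hasFDerivAt
    have h₃ : HasFDerivAt (fun x => H (x, p.2)) _ p.1 := h₂.comp p.1 h₁
    rw [h₃.fderiv]
    simp
  have han : ∀ H K : E × Z → E, AnalyticOnNhd ℝ H U → AnalyticOnNhd ℝ K U →
      AnalyticOnNhd ℝ (fun p => fderiv ℝ H p (K p, (0 : Z))) U := by
    intro H K hH hK p hp
    have h₁ : AnalyticAt ℝ (fderiv ℝ H) p := (hH p hp).fderiv
    have h₂ : AnalyticAt ℝ (fun p => (K p, (0 : Z))) p := (hK p hp).prod analyticAt_const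
    exact AnalyticAt.fun_comp (f := fun p => (fderiv ℝ H p, (K p, (0 : Z))))
      ((ContinuousLinearMap.id ℝ (E × Z →L[ℝ] E)).analyticAt_bilinear _) (h₁.prod h₂)
  refine ((han G F hG hF).sub (han F G hF hG)).congr hU fun p hp => ?_
  simp only [lieBracketVF, Pi.sub_apply]
  rw [key G hG p hp, key F hF p hp]

/-- Every element of the Lie algebra generated by an analytic family at a fixed parameter extends
to an analytic family of elements of the Lie algebras at all parameters. -/
theorem exists_analytic_family_of_mem_lieGen {E Z ι : Type*} [NormedAddCommGroup E]
    [NormedSpace ℝ E] [CompleteSpace E] [NormedAddCommGroup Z] [NormedSpace ℝ Z] {U : Set (E × Z)}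
    (hU : IsOpen U) {V : ι → E × Z → E} (hV : ∀ i, AnalyticOnNhd ℝ (V i) U) (z₀ : Z) {f : E → E}
    (hf : f ∈ lieGen (range fun i => fun x => V i (x, z₀))) :
    ∃ F : E × Z → E, AnalyticOnNhd ℝ F U ∧
      (∀ z, (fun x => F (x, z)) ∈ lieGen (range fun i => fun x => V i (x, z))) ∧
      (fun x => F (x, z₀)) = f := by
  refine hf {f | ∃ F : E × Z → E, AnalyticOnNhd ℝ F U ∧
      (∀ z, (fun x => F (x, z)) ∈ lieGen (range fun i => fun x => V i (x, z))) ∧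
      (fun x => F (x, z₀)) = f} ⟨?_, ?_, ?_, ?_, ?_⟩
  · rintro _ ⟨i, rfl⟩
    exact ⟨V i, hV i, fun z T hT => hT.1 ⟨i, rfl⟩, rfl⟩
  · exact ⟨0, analyticOnNhd_const, fun z => zero_mem_lieGen, rfl⟩
  · rintro _ _ ⟨F, hF, hF', rfl⟩ ⟨G, hG, hG', rfl⟩
    exact ⟨F + G, hF.add hG, fun z => add_mem_lieGen (hF' z) (hG' z), rfl⟩
  · rintro c _ ⟨F, hF, hF', rfl⟩
    exact ⟨c • F, hF.const_smul, fun z => smul_mem_lieGen c (hF' z), rfl⟩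
  · rintro _ _ ⟨F, hF, hF', rfl⟩ ⟨G, hG, hG', rfl⟩
    exact ⟨_, hF.lieBracketVF_fst hU hG, fun z => lieBracketVF_mem_lieGen (hF' z) (hG' z), rfl⟩

/-- The determinant of a matrix with analytic entries is analytic. -/
theorem AnalyticOnNhd.matrix_det {E n : Type*} [NormedAddCommGroup E] [NormedSpace ℝ E]
    [Fintype n] [DecidableEq n] {M : E → Matrix n n ℝ} {W : Set E}
    (hM : ∀ i j, AnalyticOnNhd ℝ (fun x => M x i j) W) :
    AnalyticOnNhd ℝ (fun x => (M x).det) W := by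
  simp only [Matrix.det_apply']
  exact Finset.analyticOnNhd_fun_sum _ fun σ _ => analyticOnNhd_const.mul
    (Finset.analyticOnNhd_fun_prod _ fun i _ => hM _ _)

/-- A family of vector fields whose evaluation matrix at a tuple is invertible spans a Lie algebra
interpolating at this tuple. -/
theorem interpolates_lieGen_of_det_ne_zero {m N : ℕ}
    {S : Set (EuclideanSpace ℝ (Fin m) → EuclideanSpace ℝ (Fin m))}
    {f : Fin N × Fin m → EuclideanSpace ℝ (Fin m) → EuclideanSpace ℝ (Fin m)}
    (hf : ∀ a, f a ∈ lieGen S) {x : Fin N → EuclideanSpace ℝ (Fin m)}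
    (hdet : (Matrix.of fun a b : Fin N × Fin m => f a (x b.1) b.2).det ≠ 0) :
    Interpolates (lieGen S) x := by
  intro v
  set M := Matrix.of fun a b : Fin N × Fin m => f a (x b.1) b.2 with hM
  set w : Fin N × Fin m → ℝ := fun b => v b.1 b.2 with hw
  set c := Matrix.vecMul w M⁻¹ with hc
  have hcM : Matrix.vecMul c M = w := by
    rw [hc, Matrix.vecMul_vecMul, Matrix.nonsing_inv_mul _ (isUnit_iff_ne_zero.2 hdet),
      Matrix.vecMul_one]
  refine ⟨∑ a, c a • f a, sum_smul_mem_lieGen _ c hf, fun i => ?_⟩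
  ext j
  have := congrFun hcM (i, j)
  simpa [Matrix.vecMul, dotProduct, hM, hw] using this

/-- A nonempty open set of `ℝ^m`, `m ≥ 1`, contains tuples at which any values can be attained by
polynomial vector fields. -/
theorem exists_tuple_forall_exists_isPolyVF {m : ℕ} (hm : 0 < m)
    {Ω : Set (EuclideanSpace ℝ (Fin m))} (hΩ : IsOpen Ω) (hne : Ω.Nonempty) (N : ℕ) :
    ∃ x : Fin N → EuclideanSpace ℝ (Fin m), (∀ i, x i ∈ Ω) ∧
      ∀ a : Fin N × Fin m, ∃ P : EuclideanSpace ℝ (Fin m) → EuclideanSpace ℝ (Fin m),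
        IsPolyVF P ∧ ∀ b : Fin N × Fin m, P (x b.1) b.2 = (1 : Matrix _ _ ℝ) a b := by
  let k : Fin m := ⟨0, hm⟩
  let π : EuclideanSpace ℝ (Fin m) →L[ℝ] ℝ := EuclideanSpace.proj k
  have hsurj : Function.Surjective π := fun t => ⟨EuclideanSpace.single k t, by simp [π]⟩
  have hinf : (π '' Ω).Infinite :=
    infinite_of_mem_nhds (π hne.some)
      ((π.isOpenMap hsurj Ω hΩ).mem_nhds (mem_image_of_mem _ hne.some_mem))
  let e : ℕ ↪ π '' Ω := hinf.natEmbedding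
  choose x hxΩ hx using fun i : Fin N => (e i).2
  have hinj : Function.Injective fun i => π (x i) := by
    intro i j hij
    simp only [hx] at hij
    exact Fin.ext (e.injective (Subtype.ext hij))
  refine ⟨x, hxΩ, fun a => ?_⟩
  let q : Polynomial ℝ := Lagrange.basis Finset.univ (fun i => π (x i)) a.1
  let p : Fin m → MvPolynomial (Fin m) ℝ := fun j =>
    if a.2 = j then Polynomial.aeval (MvPolynomial.X k) q else 0
  refine ⟨fun y => WithLp.toLp 2 fun j => MvPolynomial.eval (fun i => y i) (p j),
    ⟨p, fun _ _ => rfl⟩, fun b => ?_⟩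
  have heval : MvPolynomial.eval (fun i => x b.1 i) (Polynomial.aeval (MvPolynomial.X k) q) =
      q.eval (π (x b.1)) := by
    rw [Polynomial.aeval_def, Polynomial.hom_eval₂]
    have hC : (MvPolynomial.eval fun i => x b.1 i).comp (algebraMap ℝ (MvPolynomial (Fin m) ℝ)) =
        RingHom.id ℝ := by
      ext
      simp [MvPolynomial.algebraMap_eq]
    rw [hC, MvPolynomial.eval_X]
    rfl
  have hq : q.eval (π (x b.1)) = if a.1 = b.1 then 1 else 0 := by
    split_ifs with h
    · rw [← h]
      exact Lagrange.eval_basis_self hinj.injOn (Finset.mem_univ _)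
    · exact Lagrange.eval_basis_of_ne (v := fun i => π (x i)) h (Finset.mem_univ _)
  obtain ⟨a₁, a₂⟩ := a
  obtain ⟨b₁, b₂⟩ := b
  simp only [p, Matrix.one_apply, Prod.mk.injEq] at heval hq ⊢
  by_cases h : a₂ = b₂
  · simp [h, heval, hq]
  · simp [h]

/-- let `m ≥ 2`, `Ω ⊂ ℝ^m` bounded open connected, and let
`V_1(·,·),…,V_5(·,·) : ℝ^m × ℝ^l → ℝ^m` be real analytic on a neighborhood of
`cl(Ω) × ℝ^l` such that for some `ẑ` the Lie algebra of the `V_i(·,ẑ)` contains all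
polynomial vector fields.  Then there is a Lebesgue nullset `ℳ_N ⊂ ℝ^l` such that for
every `z ∉ ℳ_N` there is a Lebesgue nullset `𝒩_N ⊂ Ω^N` such that
`Lie(V_1(·,z),…,V_5(·,z))` interpolates at every tuple in `Ω^N ∖ 𝒩_N`. -/
theorem generic_interpolating_lie_algebra
    (m : ℕ) (hm : 2 ≤ m)
    (Ω : Set (EuclideanSpace ℝ (Fin m)))
    (hΩbdd : Bornology.IsBounded Ω) (hΩopen : IsOpen Ω) (hΩconn : IsConnected Ω)
    (l N : ℕ)
    (V : Fin 5 → (EuclideanSpace ℝ (Fin m) × EuclideanSpace ℝ (Fin l)) →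
      EuclideanSpace ℝ (Fin m))
    (hVanalytic : ∃ U : Set (EuclideanSpace ℝ (Fin m) × EuclideanSpace ℝ (Fin l)),
      IsOpen U ∧ (closure Ω) ×ˢ (Set.univ : Set (EuclideanSpace ℝ (Fin l))) ⊆ U ∧
      ∀ i, AnalyticOnNhd ℝ (V i) U)
    (zhat : EuclideanSpace ℝ (Fin l))
    (hLie : ∀ P : EuclideanSpace ℝ (Fin m) → EuclideanSpace ℝ (Fin m), IsPolyVF P →
      P ∈ lieGen (Set.range fun i => fun x => V i (x, zhat))) :
    ∃ ℳ : Set (EuclideanSpace ℝ (Fin l)), volume ℳ = 0 ∧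
      ∀ z ∉ ℳ,
        ∃ 𝒩 : Set (Fin N → EuclideanSpace ℝ (Fin m)), volume 𝒩 = 0 ∧
          𝒩 ⊆ {xbar | ∀ i, xbar i ∈ Ω} ∧
          ∀ xbar : Fin N → EuclideanSpace ℝ (Fin m), (∀ i, xbar i ∈ Ω) → xbar ∉ 𝒩 →
            Interpolates (lieGen (Set.range fun i => fun x => V i (x, z))) xbar := by
  classical
  obtain ⟨U, hUo, hUsub, hV⟩ := hVanalytic
  obtain ⟨xhat, hxhat, hpoly⟩ :=
    exists_tuple_forall_exists_isPolyVF (by omega) hΩopen hΩconn.nonempty N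
  choose P hP hPval using hpoly
  choose F hFan hFmem hFhat using fun a =>
    exists_analytic_family_of_mem_lieGen hUo hV zhat (hLie (P a) (hP a))
  let D : (Fin N → EuclideanSpace ℝ (Fin m)) → EuclideanSpace ℝ (Fin l) → ℝ := fun x z =>
    (Matrix.of fun a b : Fin N × Fin m => F a (x b.1, z) b.2).det
  have hDhat : D xhat zhat ≠ 0 := by
    have : (Matrix.of fun a b : Fin N × Fin m => F a (xhat b.1, zhat) b.2) = 1 := by
      ext a b
      rw [← hPval a b, ← hFhat a]
      rfl
    simp [D, this]
  have hmemU : ∀ x ∈ Ω, ∀ z, (x, z) ∈ U := fun x hx z => hUsub ⟨subset_closure hx, mem_univ z⟩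
  have hcoord : ∀ a (j : Fin m) x, x ∈ Ω → ∀ z, AnalyticAt ℝ (fun p => F a p j) (x, z) :=
    fun a j x hx z => (EuclideanSpace.proj (𝕜 := ℝ) j).analyticAt _ |>.comp
      (hFan a (x, z) (hmemU x hx z))
  have hDz : AnalyticOnNhd ℝ (fun z => D xhat z) univ :=
    AnalyticOnNhd.matrix_det fun a b z _ =>
      (hcoord a b.2 (xhat b.1) (hxhat b.1) z).fun_comp (analyticAt_const.prod analyticAt_id)
  have hDx : ∀ z, AnalyticOnNhd ℝ (fun x => D x z) (univ.pi fun _ => Ω) := fun z =>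
    AnalyticOnNhd.matrix_det fun a b x hx =>
      AnalyticAt.fun_comp (f := fun x : Fin N → EuclideanSpace ℝ (Fin m) => (x b.1, z))
        (hcoord a b.2 (x b.1) (hx b.1 (mem_univ _)) z)
        (((ContinuousLinearMap.proj (R := ℝ)
          (φ := fun _ : Fin N => EuclideanSpace ℝ (Fin m)) b.1).analyticAt x).prod
          analyticAt_const)
  refine ⟨{z | z ∈ univ ∧ D xhat z = 0}, hDz.measure_zeros_eq_zero volume isOpen_univ
    isPreconnected_univ (mem_univ zhat) hDhat, fun z hz => ?_⟩
  have hz' : D xhat z ≠ 0 := fun h => hz ⟨mem_univ z, h⟩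
  refine ⟨{x | x ∈ (univ.pi fun _ => Ω) ∧ D x z = 0},
    (hDx z).measure_zeros_eq_zero volume (isOpen_set_pi finite_univ fun _ _ => hΩopen)
      (isPreconnected_univ_pi fun _ => hΩconn.isPreconnected) (fun i _ => hxhat i) hz',
    fun x hx i => hx.1 i (mem_univ i), fun x hxΩ hx => ?_⟩
  exact interpolates_lieGen_of_det_ne_zero (fun a => hFmem a z)
    fun h => hx ⟨fun i _ => hxΩ i, h⟩
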